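/- The number of standard Young tableaux of a given shape λ with |λ| boxes equals |λ|! divided by the product over all boxes s of λ of the hook length h(s). -/

import Mathlib

/-- The hook length of a cell `(i, j)` of a Young diagram `μ`: the number of boxes to
the right of it in its row plus the number of boxes below it in its column, plus one
for the box itself (so `(rowLen i - j) + (colLen j - i) - 1`). -/
def hookLength (μ : YoungDiagram) (c : ℕ × ℕ) : ℕ :=
  (μ.rowLen c.1 - c.2) + (μ.colLen c.2 - c.1) - 1

section

open Finset Polynomial

/-- The numerator `X * ∏ (X - x i - 1)` modulo `∏ (X - x i)`, with its top coefficient. -/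
theorem exists_polynomial_shift (x : ℕ → ℚ) (k : ℕ) : ∃ R : ℚ[X], R.degree < k ∧
    (X * R).coeff k = ∑ i ∈ range k, ((i : ℚ) - x i) ∧
    X * ∏ i ∈ range k, (X - C (x i + 1)) =
      (X - C (k : ℚ)) * ∏ i ∈ range k, (X - C (x i)) + R := by
  induction k with
  | zero => exact ⟨0, by simp, by simp, by simp⟩
  | succ k ih =>
    obtain ⟨R, hdeg, hcoeff, hR⟩ := ih
    have hmonic : (∏ i ∈ range k, (X - C (x i))).Monic := monic_prod_X_sub_C _ _
    have hnat : (∏ i ∈ range k, (X - C (x i))).natDegree = k := by simp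
    have hN : (∏ i ∈ range k, (X - C (x i))).degree < ((k + 1 : ℕ) : WithBot ℕ) := by
      rw [degree_eq_natDegree hmonic.ne_zero, hnat]
      exact_mod_cast Nat.lt_succ_self k
    refine ⟨C (k - x k) * ∏ i ∈ range k, (X - C (x i)) + R * (X - C (x k + 1)), ?_, ?_, ?_⟩
    · refine lt_of_le_of_lt (degree_add_le _ _) (max_lt ?_ ?_)
      · rw [← smul_eq_C_mul]
        exact lt_of_le_of_lt (degree_smul_le _ _) hN
      · rw [degree_mul, degree_X_sub_C]
        push_cast
        exact WithBot.add_lt_add_right (by decide) hdeg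
    · rw [sum_range_succ, ← hcoeff, coeff_X_mul, mul_sub, coeff_add, coeff_sub, coeff_C_mul,
        coeff_mul_C, coeff_eq_zero_of_degree_lt hdeg, mul_comm R X]
      have := hmonic.coeff_natDegree
      rw [hnat] at this
      rw [this]; ring
    · rw [prod_range_succ, prod_range_succ, ← mul_assoc, hR]
      simp only [C_add, C_sub, C_1, Nat.cast_add, Nat.cast_one]
      ring

/-- Deleting `x r` from a Vandermonde product leaves a factor independent of `x r`. -/
theorem exists_prod_sub_update (x : ℕ → ℚ) (r k : ℕ) (hr : r < k) : ∃ c : ℚ, ∀ y : ℚ,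
    ∏ m ∈ range k, ∏ i ∈ range m, (Function.update x r y i - Function.update x r y m) =
      c * ∏ j ∈ (range k).erase r, (y - x j) := by
  induction k with
  | zero => omega
  | succ k ih =>
    rcases Nat.lt_succ_iff_lt_or_eq.1 hr with h | rfl
    · obtain ⟨c, hc⟩ := ih h
      refine ⟨c * ∏ i ∈ (range k).erase r, (x i - x k), fun y => ?_⟩
      rw [prod_range_succ, hc, range_add_one, erase_insert_of_ne (by omega),
        prod_insert (by simp), ← mul_prod_erase (range k) _ (mem_range.2 h)]
      have : ∏ i ∈ (range k).erase r, (Function.update x r y i - Function.update x r y k) =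
          ∏ i ∈ (range k).erase r, (x i - x k) := by
        refine prod_congr rfl fun i hi => ?_
        rw [Function.update_of_ne (mem_erase.1 hi).1, Function.update_of_ne (by omega)]
      rw [this, Function.update_self, Function.update_of_ne (by omega)]
      ring
    · refine ⟨(∏ m ∈ range r, ∏ i ∈ range m, (x i - x m)) * (-1) ^ r, fun y => ?_⟩
      rw [prod_range_succ, range_add_one, erase_insert (by simp), mul_assoc]
      congr 1
      · refine prod_congr rfl fun m hm => prod_congr rfl fun i hi => ?_
        rw [mem_range] at hm hi
        rw [Function.update_of_ne (by omega), Function.update_of_ne (by omega)]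
      · have : ∀ i ∈ range r, Function.update x r y i - Function.update x r y r
            = -1 * (y - x i) := fun i hi => by
          rw [mem_range] at hi
          rw [Function.update_of_ne (by omega), Function.update_self]; ring
        rw [prod_congr rfl this, prod_mul_distrib]; simp

theorem sum_mul_prod_sub_one_div (x : ℕ → ℚ) (k : ℕ) (hx : Set.InjOn x (range k)) :
    ∑ i ∈ range k, x i * (∏ j ∈ (range k).erase i, (x i - 1 - x j)) /
      (∏ j ∈ (range k).erase i, (x i - x j)) = ∑ i ∈ range k, (x i - i) := by
  obtain ⟨R, hdeg, hcoeff, hR⟩ := exists_polynomial_shift x k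
  rcases k with _ | k
  · simp
  have h := Lagrange.coeff_eq_sum (s := range (k + 1)) hx (P := R) (by simpa using hdeg)
  rw [card_range, Nat.add_sub_cancel, ← coeff_X_mul, hcoeff] at h
  have heval : ∀ i ∈ range (k + 1), R.eval (x i) =
      -(x i * ∏ j ∈ (range (k + 1)).erase i, (x i - 1 - x j)) := by
    intro i hi
    have := congrArg (eval (x i)) hR
    simp only [eval_mul, eval_X, eval_prod, eval_sub, eval_C, eval_add] at this
    rw [← mul_prod_erase _ _ hi, ← mul_prod_erase _ (fun j => x i - x j) hi] at this
    simp only [sub_add_eq_sub_sub_swap] at this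
    linear_combination -this
  have hneg : ∑ i ∈ range (k + 1), (x i - i) = -∑ i ∈ range (k + 1), ((i : ℚ) - x i) := by
    rw [← sum_neg_distrib]; simp
  rw [hneg, h, ← sum_neg_distrib]
  refine sum_congr rfl fun i hi => ?_
  rw [heval i hi, neg_div, neg_neg]

namespace YoungDiagram

/-- The shifted row length `λ_i + (k - 1 - i)`, the hook length of the first cell of row `i`
when `k` is the number of rows. -/
def shiftedLen (μ : YoungDiagram) (k i : ℕ) : ℕ := μ.rowLen i + (k - 1 - i)

theorem shiftedLen_lt (μ : YoungDiagram) {k i m : ℕ} (him : i < m) (hm : m < k) :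
    μ.shiftedLen k m < μ.shiftedLen k i := by
  have := μ.rowLen_anti i m him.le
  unfold shiftedLen
  omega

theorem injOn_shiftedLen (μ : YoungDiagram) (k : ℕ) :
    Set.InjOn (fun i => (μ.shiftedLen k i : ℚ)) (range k) := by
  intro a ha b hb hab
  simp only [coe_range, Set.mem_Iio] at ha hb
  have hab : μ.shiftedLen k a = μ.shiftedLen k b := Nat.cast_injective hab
  rcases lt_trichotomy a b with h | h | h
  · have := μ.shiftedLen_lt h hb
    omega
  · exact h
  · have := μ.shiftedLen_lt h ha
    omega

theorem lt_rowLen_iff_lt_colLen (μ : YoungDiagram) {i j : ℕ} :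
    j < μ.rowLen i ↔ i < μ.colLen j := by
  rw [← mem_iff_lt_rowLen, mem_iff_lt_colLen]

/-- The hook lengths in row `i` and the differences of shifted row lengths
partition `{1, …, λ_i + k - 1 - i}`. -/
theorem prod_hookLength_row (μ : YoungDiagram) {k i : ℕ} (hi : i < k)
    (hk : μ.colLen 0 ≤ k) :
    (∏ j ∈ range (μ.rowLen i), hookLength μ (i, j)) *
      ∏ m ∈ Ioo i k, (μ.shiftedLen k i - μ.shiftedLen k m) =
        (μ.shiftedLen k i).factorial := by
  have hcol : ∀ j, μ.colLen j ≤ k := fun j => (μ.colLen_anti 0 j (Nat.zero_le _)).trans hk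
  have hinj₁ : Set.InjOn (fun j => hookLength μ (i, j)) (range (μ.rowLen i)) := by
    have key : ∀ a b, a < b → b < μ.rowLen i → hookLength μ (i, b) < hookLength μ (i, a) := by
      intro a b hab hb
      have h₁ := μ.colLen_anti a b hab.le
      have h₂ := μ.lt_rowLen_iff_lt_colLen.1 hb
      simp only [hookLength]
      omega
    intro a ha b hb hab
    simp only [coe_range, Set.mem_Iio] at ha hb hab
    rcases lt_trichotomy a b with h | h | h
    · have := key a b h hb
      omega
    · exact h
    · have := key b a h ha
      omega
  have hinj₂ : Set.InjOn (fun m => μ.shiftedLen k i - μ.shiftedLen k m) (Ioo i k) := by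
    intro a ha b hb hab
    simp only [coe_Ioo, Set.mem_Ioo] at ha hb hab
    have h₁ := μ.shiftedLen_lt ha.1 ha.2
    have h₂ := μ.shiftedLen_lt hb.1 hb.2
    exact μ.injOn_shiftedLen k (by simp [ha.2]) (by simp [hb.2])
      (by simp only [Nat.cast_inj]; omega)
  have hdisj : Disjoint ((range (μ.rowLen i)).image fun j => hookLength μ (i, j))
      ((Ioo i k).image fun m => μ.shiftedLen k i - μ.shiftedLen k m) := by
    rw [disjoint_left]
    intro _ ha hb
    obtain ⟨j, hj, rfl⟩ := mem_image.1 ha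
    obtain ⟨m, hm, hjm⟩ := mem_image.1 hb
    rw [mem_range] at hj
    rw [mem_Ioo] at hm
    have h₁ := μ.lt_rowLen_iff_lt_colLen.1 hj
    have h₂ := μ.shiftedLen_lt hm.1 hm.2
    have h₃ := μ.lt_rowLen_iff_lt_colLen (i := m) (j := j)
    simp only [hookLength, shiftedLen] at hjm h₂
    omega
  have hunion : ((range (μ.rowLen i)).image fun j => hookLength μ (i, j)) ∪
      ((Ioo i k).image fun m => μ.shiftedLen k i - μ.shiftedLen k m) =
        Icc 1 (μ.shiftedLen k i) := by
    refine eq_of_subset_of_card_le (union_subset ?_ ?_) ?_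
    · intro _ ha
      obtain ⟨j, hj, rfl⟩ := mem_image.1 ha
      rw [mem_range] at hj
      have h₁ := μ.lt_rowLen_iff_lt_colLen.1 hj
      have h₂ := hcol j
      simp only [mem_Icc, hookLength, shiftedLen]
      omega
    · intro _ ha
      obtain ⟨m, hm, rfl⟩ := mem_image.1 ha
      rw [mem_Ioo] at hm
      have := μ.shiftedLen_lt hm.1 hm.2
      rw [mem_Icc]
      omega
    · rw [card_union_of_disjoint hdisj, card_image_of_injOn hinj₁, card_image_of_injOn hinj₂]
      simp only [Nat.card_Icc, card_range, Nat.card_Ioo, shiftedLen]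
      omega
  rw [← prod_Ico_id_eq_factorial,
    show Ico 1 (μ.shiftedLen k i + 1) = Icc 1 (μ.shiftedLen k i) from rfl, ← hunion,
    prod_union hdisj, prod_image hinj₁,
    prod_image hinj₂]

theorem mem_cells_iff_row (μ : YoungDiagram) {k : ℕ} (hk : μ.colLen 0 ≤ k) (p : ℕ × ℕ) :
    p ∈ μ.cells ↔ p.1 ∈ range k ∧ p.2 ∈ range (μ.rowLen p.1) := by
  rw [mem_cells, mem_range, mem_range, ← mem_iff_lt_rowLen, iff_and_self]
  intro h
  have := mem_iff_lt_colLen.1 (μ.up_left_mem le_rfl (Nat.zero_le p.2) h)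
  omega

theorem prod_hookLength_mul_prod_sub (μ : YoungDiagram) {k : ℕ} (hk : μ.colLen 0 ≤ k) :
    (∏ c ∈ μ.cells, (hookLength μ c : ℚ)) * ∏ m ∈ range k, ∏ i ∈ range m,
      ((μ.shiftedLen k i : ℚ) - μ.shiftedLen k m) =
        ∏ i ∈ range k, ((μ.shiftedLen k i).factorial : ℚ) := by
  have hcomm : ∏ m ∈ range k, ∏ i ∈ range m, ((μ.shiftedLen k i : ℚ) - μ.shiftedLen k m) =
      ∏ i ∈ range k, ∏ m ∈ Ioo i k, ((μ.shiftedLen k i : ℚ) - μ.shiftedLen k m) :=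
    prod_comm' (by intro a b; simp only [mem_range, mem_Ioo]; omega)
  rw [prod_finset_product μ.cells (range k) (fun i => range (μ.rowLen i))
    (μ.mem_cells_iff_row hk), hcomm, ← prod_mul_distrib]
  refine prod_congr rfl fun i hi => ?_
  rw [← μ.prod_hookLength_row (mem_range.1 hi) hk, Nat.cast_mul, Nat.cast_prod, Nat.cast_prod]
  congr 1
  refine prod_congr rfl fun m hm => ?_
  rw [mem_Ioo] at hm
  rw [Nat.cast_sub (μ.shiftedLen_lt hm.1 hm.2).le]

theorem sum_shiftedLen_sub (μ : YoungDiagram) {k : ℕ} (hk : μ.colLen 0 ≤ k) :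
    ∑ i ∈ range k, ((μ.shiftedLen k i : ℚ) - i) = μ.card := by
  have hcard : μ.card = ∑ i ∈ range k, μ.rowLen i := by
    rw [YoungDiagram.card, card_eq_sum_ones, sum_finset_product μ.cells (range k)
      (fun i => range (μ.rowLen i)) (μ.mem_cells_iff_row hk)]
    simp
  have hrefl := sum_range_reflect (fun i => (i : ℚ)) k
  simp only [shiftedLen, Nat.cast_add, sum_sub_distrib, sum_add_distrib, hrefl, hcard,
    Nat.cast_sum]
  ring

/-- The Young diagram obtained by deleting the last cell of a row strictly longer than the next. -/
def eraseCorner (μ : YoungDiagram) (r : ℕ) (h : μ.rowLen (r + 1) < μ.rowLen r) :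
    YoungDiagram where
  cells := μ.cells.erase (r, μ.rowLen r - 1)
  isLowerSet := by
    rintro ⟨a, b⟩ ⟨i, j⟩ ⟨hi, hj⟩ hab
    simp only [coe_erase, Set.mem_sdiff, mem_coe, mem_cells, Set.mem_singleton_iff,
      Prod.mk.injEq] at hab hi hj ⊢
    refine ⟨μ.up_left_mem hi hj hab.1, ?_⟩
    rintro ⟨rfl, rfl⟩
    have h₁ := mem_iff_lt_rowLen.1 hab.1
    rcases hi.eq_or_lt with rfl | hlt
    · exact hab.2 ⟨rfl, by omega⟩
    · have := μ.rowLen_anti (i + 1) a hlt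
      omega

variable {μ : YoungDiagram} {r : ℕ} (h : μ.rowLen (r + 1) < μ.rowLen r)

theorem mem_eraseCorner {c : ℕ × ℕ} :
    c ∈ μ.eraseCorner r h ↔ c ≠ (r, μ.rowLen r - 1) ∧ c ∈ μ := by
  rw [← mem_cells, eraseCorner, mem_erase, mem_cells]

theorem corner_mem (h : μ.rowLen (r + 1) < μ.rowLen r) : (r, μ.rowLen r - 1) ∈ μ := by
  rw [mem_iff_lt_rowLen]
  omega

theorem card_eraseCorner_add_one : (μ.eraseCorner r h).card + 1 = μ.card :=
  card_erase_add_one ((mem_cells _).2 (corner_mem h))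

theorem rowLen_eraseCorner (i : ℕ) :
    (μ.eraseCorner r h).rowLen i = if i = r then μ.rowLen r - 1 else μ.rowLen i := by
  refine eq_of_forall_lt_iff fun j => ?_
  rw [← mem_iff_lt_rowLen, mem_eraseCorner, mem_iff_lt_rowLen, Ne, Prod.mk.injEq]
  split_ifs with hi
  · subst hi
    omega
  · simp [hi]

theorem colLen_zero_eraseCorner_le : (μ.eraseCorner r h).colLen 0 ≤ μ.colLen 0 := by
  refine le_of_forall_lt fun i hi => ?_
  rw [← mem_iff_lt_colLen] at hi ⊢
  exact ((mem_eraseCorner h).1 hi).2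

/-- Comparison of hook products before and after deleting a corner. -/
theorem prod_hookLength_eraseCorner (hr : r < μ.colLen 0) :
    (∏ c ∈ μ.cells, (hookLength μ c : ℚ)) * ∏ j ∈ (range (μ.colLen 0)).erase r,
        ((μ.shiftedLen (μ.colLen 0) r : ℚ) - μ.shiftedLen (μ.colLen 0) j) =
      (∏ c ∈ (μ.eraseCorner r h).cells, (hookLength (μ.eraseCorner r h) c : ℚ)) *
        (μ.shiftedLen (μ.colLen 0) r * ∏ j ∈ (range (μ.colLen 0)).erase r,
          ((μ.shiftedLen (μ.colLen 0) r : ℚ) - 1 - μ.shiftedLen (μ.colLen 0) j)) := by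
  have h₁ := μ.prod_hookLength_mul_prod_sub le_rfl
  have h₂ := (μ.eraseCorner r h).prod_hookLength_mul_prod_sub (colLen_zero_eraseCorner_le h)
  set k := μ.colLen 0
  obtain ⟨c, hc⟩ := exists_prod_sub_update (fun i => (μ.shiftedLen k i : ℚ)) r k hr
  have hpos : 0 < μ.shiftedLen k r := by
    unfold shiftedLen
    omega
  have hupd : ∀ i, ((μ.eraseCorner r h).shiftedLen k i : ℚ) =
      Function.update (fun i => (μ.shiftedLen k i : ℚ)) r (μ.shiftedLen k r - 1) i := by
    intro i
    rcases eq_or_ne i r with rfl | hi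
    · rw [Function.update_self, ← Nat.cast_pred hpos, Nat.cast_inj]
      simp only [shiftedLen, rowLen_eraseCorner, if_true]
      omega
    · rw [Function.update_of_ne hi]
      simp [shiftedLen, rowLen_eraseCorner, hi]
  have hc₁ := hc (μ.shiftedLen k r)
  rw [Function.update_eq_self] at hc₁
  have hc₂ := hc (μ.shiftedLen k r - 1)
  simp only [← hupd] at hc₂
  rw [hc₁] at h₁
  rw [hc₂] at h₂
  have hfact : ∏ i ∈ range k, ((μ.shiftedLen k i).factorial : ℚ) = μ.shiftedLen k r *
      ∏ i ∈ range k, (((μ.eraseCorner r h).shiftedLen k i).factorial : ℚ) := by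
    rw [← mul_prod_erase _ _ (mem_range.2 hr), ← mul_prod_erase (range k)
      (fun i => (((μ.eraseCorner r h).shiftedLen k i).factorial : ℚ)) (mem_range.2 hr),
      ← mul_assoc]
    congr 1
    · have : (μ.eraseCorner r h).shiftedLen k r = μ.shiftedLen k r - 1 := by
        simp only [shiftedLen, rowLen_eraseCorner, if_true]
        omega
      rw [this, ← Nat.cast_mul, Nat.mul_factorial_pred hpos.ne']
    · refine prod_congr rfl fun i hi => ?_
      simp [shiftedLen, rowLen_eraseCorner, (mem_erase.1 hi).1]
  have hne : c ≠ 0 := by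
    rintro rfl
    rw [zero_mul, mul_zero] at h₁
    exact prod_ne_zero_iff.2 (fun i _ => Nat.cast_ne_zero.2 (Nat.factorial_ne_zero _)) h₁.symm
  refine mul_left_cancel₀ hne ?_
  linear_combination h₁ - (μ.shiftedLen k r : ℚ) * h₂ + hfact

/-- The standard Young tableaux of shape `μ`, as functions on `ℕ × ℕ` vanishing off `μ`. -/
def IsStandardTableau (μ : YoungDiagram) (f : ℕ × ℕ → ℕ) : Prop :=
  (∀ c ∉ μ, f c = 0) ∧ (∀ c ∈ μ, 1 ≤ f c ∧ f c ≤ μ.card) ∧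
    (∀ c ∈ μ, ∀ d ∈ μ, f c = f d → c = d) ∧
    (∀ c ∈ μ, ∀ d ∈ μ, c.1 = d.1 → c.2 < d.2 → f c < f d) ∧
    (∀ c ∈ μ, ∀ d ∈ μ, c.2 = d.2 → c.1 < d.1 → f c < f d)

theorem finite_isStandardTableau (μ : YoungDiagram) : {f | μ.IsStandardTableau f}.Finite := by
  have hfin : Finite {f // μ.IsStandardTableau f} := by
    refine Finite.of_injective
      (fun f (c : μ.cells) => (⟨f.1 c, Nat.lt_succ_of_le (f.2.2.1 c ((mem_cells _).1 c.2)).2⟩ :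
        Fin (μ.card + 1))) ?_
    intro f g hfg
    ext c
    by_cases hc : c ∈ μ
    · exact congrArg Fin.val (congrFun hfg ⟨c, (mem_cells _).2 hc⟩)
    · rw [f.2.1 c hc, g.2.1 c hc]
  exact hfin

/-- The finset of standard Young tableaux of shape `μ`. -/
noncomputable def standardTableaux (μ : YoungDiagram) : Finset (ℕ × ℕ → ℕ) :=
  μ.finite_isStandardTableau.toFinset

theorem mem_standardTableaux {μ : YoungDiagram} {f : ℕ × ℕ → ℕ} :
    f ∈ μ.standardTableaux ↔ μ.IsStandardTableau f := by
  simp [standardTableaux]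

/-- The maximal entry of a standard tableau sits at a corner. -/
theorem IsStandardTableau.exists_corner {μ : YoungDiagram} {f : ℕ × ℕ → ℕ}
    (hf : μ.IsStandardTableau f) (hμ : 0 < μ.card) :
    ∃ r < μ.colLen 0, μ.rowLen (r + 1) < μ.rowLen r ∧ f (r, μ.rowLen r - 1) = μ.card := by
  obtain ⟨-, hbd, hinj, hrow, hcol⟩ := hf
  obtain ⟨⟨i, j⟩, hc, hfc⟩ : ∃ c ∈ μ.cells, f c = μ.card := by
    have := surjOn_of_injOn_of_card_le (s := μ.cells) (t := Icc 1 μ.card) f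
      (fun c hc => by simpa using hbd c hc)
      (fun c hc d hd => hinj c hc d hd) (by simp [YoungDiagram.card])
    obtain ⟨c, hc, h⟩ := this (by simpa using hμ : μ.card ∈ (Icc 1 μ.card : Set ℕ))
    exact ⟨c, hc, h⟩
  rw [mem_cells] at hc
  have hj := mem_iff_lt_rowLen.1 hc
  have hr : μ.rowLen i = j + 1 := by
    by_contra hne
    have hmem : (i, j + 1) ∈ μ := mem_iff_lt_rowLen.2 (by omega)
    have h₁ := hrow _ hc _ hmem rfl (Nat.lt_succ_self j)
    have h₂ := (hbd _ hmem).2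
    omega
  refine ⟨i, mem_iff_lt_colLen.1 (μ.up_left_mem le_rfl (Nat.zero_le j) hc), ?_, ?_⟩
  · by_contra hlt
    have hmem : (i + 1, j) ∈ μ := mem_iff_lt_rowLen.2 (by omega)
    have h₁ := hcol _ hc _ hmem rfl (Nat.lt_succ_self i)
    have h₂ := (hbd _ hmem).2
    omega
  · rw [hr, Nat.add_sub_cancel, hfc]

theorem IsStandardTableau.update_zero {f : ℕ × ℕ → ℕ} (hf : μ.IsStandardTableau f)
    (hmax : f (r, μ.rowLen r - 1) = μ.card) :
    (μ.eraseCorner r h).IsStandardTableau (Function.update f (r, μ.rowLen r - 1) 0) := by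
  obtain ⟨hoff, hbd, hinj, hrow, hcol⟩ := hf
  have hcard := card_eraseCorner_add_one h
  have hup : ∀ c ∈ μ.eraseCorner r h,
      c ∈ μ ∧ Function.update f (r, μ.rowLen r - 1) 0 c = f c := fun c hc =>
    ⟨((mem_eraseCorner h).1 hc).2, Function.update_of_ne ((mem_eraseCorner h).1 hc).1 _ _⟩
  refine ⟨fun c hc => ?_, fun c hc => ?_, fun c hc d hd => ?_, fun c hc d hd => ?_,
    fun c hc d hd => ?_⟩
  · by_cases hcr : c = (r, μ.rowLen r - 1)
    · rw [hcr, Function.update_self]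
    · rw [Function.update_of_ne hcr]
      exact hoff c fun hcμ => hc ((mem_eraseCorner h).2 ⟨hcr, hcμ⟩)
  · rw [(hup c hc).2]
    have h₁ := hbd c (hup c hc).1
    have h₂ : f c ≠ f (r, μ.rowLen r - 1) := fun he =>
      ((mem_eraseCorner h).1 hc).1 (hinj _ (hup c hc).1 _ (corner_mem h) he)
    omega
  · rw [(hup c hc).2, (hup d hd).2]
    exact hinj _ (hup c hc).1 _ (hup d hd).1
  · rw [(hup c hc).2, (hup d hd).2]
    exact hrow _ (hup c hc).1 _ (hup d hd).1
  · rw [(hup c hc).2, (hup d hd).2]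
    exact hcol _ (hup c hc).1 _ (hup d hd).1

theorem IsStandardTableau.update_card {f : ℕ × ℕ → ℕ}
    (hf : (μ.eraseCorner r h).IsStandardTableau f) :
    μ.IsStandardTableau (Function.update f (r, μ.rowLen r - 1) μ.card) := by
  obtain ⟨hoff, hbd, hinj, hrow, hcol⟩ := hf
  have hcard := card_eraseCorner_add_one h
  have hup : ∀ c ∈ μ, c = (r, μ.rowLen r - 1) ∨ c ∈ μ.eraseCorner r h ∧
      c ≠ (r, μ.rowLen r - 1) := fun c hc =>
    or_iff_not_imp_left.2 fun hne => ⟨(mem_eraseCorner h).2 ⟨hne, hc⟩, hne⟩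
  have hlast : (r, μ.rowLen r) ∉ μ := fun hmem => (mem_iff_lt_rowLen.1 hmem).false
  refine ⟨fun c hc => ?_, fun c hc => ?_, fun c hc d hd => ?_, fun c hc d hd h₁ h₂ => ?_,
    fun c hc d hd h₁ h₂ => ?_⟩
  · have hcr : c ≠ (r, μ.rowLen r - 1) := fun he => hc (he ▸ corner_mem h)
    rw [Function.update_of_ne hcr]
    exact hoff c fun hcμ => hc ((mem_eraseCorner h).1 hcμ).2
  · rcases hup c hc with rfl | ⟨hce, hne⟩
    · rw [Function.update_self]
      omega
    · rw [Function.update_of_ne hne]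
      have := hbd c hce
      omega
  · rcases hup c hc with rfl | ⟨hce, hne⟩ <;> rcases hup d hd with rfl | ⟨hde, hne'⟩
    · exact fun _ => rfl
    · rw [Function.update_self, Function.update_of_ne hne']
      have := hbd d hde
      omega
    · rw [Function.update_self, Function.update_of_ne hne]
      have := hbd c hce
      omega
    · rw [Function.update_of_ne hne, Function.update_of_ne hne']
      exact hinj _ hce _ hde
  · rcases hup d hd with rfl | ⟨hde, hne'⟩
    · rcases hup c hc with rfl | ⟨hce, hne⟩
      · exact absurd h₂ (lt_irrefl _)
      · rw [Function.update_self, Function.update_of_ne hne]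
        have := hbd c hce
        omega
    · rcases hup c hc with rfl | ⟨hce, hne⟩
      · have := mem_iff_lt_rowLen.1 (show (d.1, d.2) ∈ μ from hd)
        simp only at h₁ h₂
        rw [← h₁] at this
        omega
      · rw [Function.update_of_ne hne, Function.update_of_ne hne']
        exact hrow _ hce _ hde h₁ h₂
  · rcases hup d hd with rfl | ⟨hde, hne'⟩
    · rcases hup c hc with rfl | ⟨hce, hne⟩
      · exact absurd h₂ (lt_irrefl _)
      · rw [Function.update_self, Function.update_of_ne hne]
        have := hbd c hce
        omega
    · rcases hup c hc with rfl | ⟨hce, hne⟩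
      · have h₃ := mem_iff_lt_rowLen.1 (show (d.1, d.2) ∈ μ from hd)
        have h₄ := μ.rowLen_anti (r + 1) d.1 h₂
        simp only at h₁ h₂
        omega
      · rw [Function.update_of_ne hne, Function.update_of_ne hne']
        exact hcol _ hce _ hde h₁ h₂

/-- Tableaux whose maximal entry is at a given corner are the tableaux of the diagram
with that corner deleted. -/
theorem card_filter_standardTableaux :
    #{f ∈ μ.standardTableaux | f (r, μ.rowLen r - 1) = μ.card} =
      #(μ.eraseCorner r h).standardTableaux := by
  refine card_nbij' (fun f => Function.update f (r, μ.rowLen r - 1) 0)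
    (fun f => Function.update f (r, μ.rowLen r - 1) μ.card) ?_ ?_ ?_ ?_
  · intro f hf
    simp only [coe_filter, Set.mem_ofPred_eq, mem_standardTableaux] at hf
    exact mem_standardTableaux.2 (hf.1.update_zero h hf.2)
  · intro f hf
    simp only [mem_coe, mem_standardTableaux] at hf
    simp only [coe_filter, Set.mem_ofPred_eq, mem_standardTableaux]
    exact ⟨hf.update_card h, Function.update_self _ _ _⟩
  · intro f hf
    simp only [coe_filter, Set.mem_ofPred_eq] at hf
    simp [← hf.2]
  · intro f hf
    simp only [mem_coe, mem_standardTableaux] at hf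
    have := hf.1 (r, μ.rowLen r - 1) fun hmem => ((mem_eraseCorner h).1 hmem).1 rfl
    simp [← this]

theorem card_standardTableaux (hμ : 0 < μ.card) :
    #μ.standardTableaux = ∑ r ∈ range (μ.colLen 0),
      #{f ∈ μ.standardTableaux | μ.rowLen (r + 1) < μ.rowLen r ∧
        f (r, μ.rowLen r - 1) = μ.card} := by
  classical
  rw [← card_biUnion]
  · congr 1
    ext f
    simp only [mem_biUnion, mem_filter, mem_range, mem_standardTableaux]
    constructor
    · intro hf
      obtain ⟨r, hr, hlt, hmax⟩ := hf.exists_corner hμ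
      exact ⟨r, hr, hf, hlt, hmax⟩
    · rintro ⟨_, _, hf, _⟩
      exact hf
  · intro a _ b _ hab
    rw [Function.onFun, disjoint_left]
    intro f hfa hfb
    simp only [mem_filter, mem_standardTableaux] at hfa hfb
    have := hfa.1.2.2.1 _ (corner_mem hfa.2.1) _ (corner_mem hfb.2.1)
      (hfa.2.2.trans hfb.2.2.symm)
    exact hab (congrArg Prod.fst this)

theorem card_standardTableaux_mul_prod_hookLength (n : ℕ) : ∀ μ : YoungDiagram, μ.card = n →
    (#μ.standardTableaux : ℚ) * ∏ c ∈ μ.cells, (hookLength μ c : ℚ) = n.factorial := by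
  induction n with
  | zero =>
    intro μ hμ
    have hempty : μ.cells = ∅ := card_eq_zero.1 hμ
    have hnot : ∀ c, c ∉ μ := fun c hc => by
      rw [← mem_cells, hempty] at hc
      simp at hc
    have : μ.standardTableaux = {0} := by
      ext f
      rw [mem_standardTableaux, mem_singleton]
      constructor
      · intro hf
        ext c
        exact hf.1 c (hnot c)
      · rintro rfl
        exact ⟨fun _ _ => rfl, fun c hc => absurd hc (hnot c), fun c hc => absurd hc (hnot c),
          fun c hc => absurd hc (hnot c), fun c hc => absurd hc (hnot c)⟩
    simp [this, hempty]
  | succ n ih =>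
    intro μ hμ
    have hinj := μ.injOn_shiftedLen (μ.colLen 0)
    have key : ∀ r ∈ range (μ.colLen 0),
        (#{f ∈ μ.standardTableaux | μ.rowLen (r + 1) < μ.rowLen r ∧
          f (r, μ.rowLen r - 1) = μ.card} : ℚ) * ∏ c ∈ μ.cells, (hookLength μ c : ℚ) =
        n.factorial * ((μ.shiftedLen (μ.colLen 0) r : ℚ) *
          (∏ j ∈ (range (μ.colLen 0)).erase r,
            ((μ.shiftedLen (μ.colLen 0) r : ℚ) - 1 - μ.shiftedLen (μ.colLen 0) j)) /
          ∏ j ∈ (range (μ.colLen 0)).erase r,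
            ((μ.shiftedLen (μ.colLen 0) r : ℚ) - μ.shiftedLen (μ.colLen 0) j)) := by
      intro r hr
      have hne : ∏ j ∈ (range (μ.colLen 0)).erase r,
          ((μ.shiftedLen (μ.colLen 0) r : ℚ) - μ.shiftedLen (μ.colLen 0) j) ≠ 0 := by
        refine prod_ne_zero_iff.2 fun j hj => sub_ne_zero.2 fun he => ?_
        exact (mem_erase.1 hj).1 (hinj hr (mem_erase.1 hj).2 he).symm
      by_cases h : μ.rowLen (r + 1) < μ.rowLen r
      · simp only [h, true_and, card_filter_standardTableaux h]
        have h₁ := prod_hookLength_eraseCorner h (mem_range.1 hr)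
        have h₂ := ih (μ.eraseCorner r h) (by have := card_eraseCorner_add_one h; omega)
        rw [← mul_div_assoc, eq_div_iff hne, mul_assoc, h₁, ← mul_assoc, h₂]
      · have hrow := μ.rowLen_anti r (r + 1) (Nat.le_succ r)
        have hpos : 0 < μ.rowLen r := μ.lt_rowLen_iff_lt_colLen.2 (mem_range.1 hr)
        have hr' : r + 1 < μ.colLen 0 := μ.lt_rowLen_iff_lt_colLen.1 (by omega)
        have hzero : ∏ j ∈ (range (μ.colLen 0)).erase r,
            ((μ.shiftedLen (μ.colLen 0) r : ℚ) - 1 - μ.shiftedLen (μ.colLen 0) j) = 0 := by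
          refine prod_eq_zero (i := r + 1) (by simp [hr']) ?_
          have : μ.shiftedLen (μ.colLen 0) r = μ.shiftedLen (μ.colLen 0) (r + 1) + 1 := by
            unfold shiftedLen
            omega
          rw [this]
          push_cast
          ring
        simp [h, hzero]
    rw [card_standardTableaux (by omega), Nat.cast_sum, sum_mul, sum_congr rfl key, ← mul_sum,
      sum_mul_prod_sub_one_div _ _ hinj, μ.sum_shiftedLen_sub le_rfl, hμ, Nat.factorial_succ,
      Nat.cast_mul, mul_comm]

theorem natCard_subtype_eq_card_standardTableaux (μ : YoungDiagram) :
    Nat.card {f : μ.cells → Fin μ.card // Function.Bijective f ∧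
        (∀ a b : μ.cells, a.1.1 = b.1.1 → a.1.2 < b.1.2 → f a < f b) ∧
        (∀ a b : μ.cells, a.1.2 = b.1.2 → a.1.1 < b.1.1 → f a < f b)} =
      #μ.standardTableaux := by
  rw [standardTableaux, ← Nat.card_eq_card_finite_toFinset]
  symm
  refine Nat.card_congr (Equiv.ofBijective (fun f => ⟨fun c => ⟨f.1 c - 1, ?_⟩, ?_, ?_, ?_⟩) ?_)
  · have := f.2.2.1 c ((mem_cells _).1 c.2)
    omega
  · rw [Fintype.bijective_iff_injective_and_card]
    refine ⟨fun a b hab => ?_, by simp [YoungDiagram.card]⟩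
    have ha := f.2.2.1 a ((mem_cells _).1 a.2)
    have hb := f.2.2.1 b ((mem_cells _).1 b.2)
    have hab := congrArg Fin.val hab
    simp only at hab
    exact Subtype.ext (f.2.2.2.1 _ ((mem_cells _).1 a.2) _ ((mem_cells _).1 b.2) (by omega))
  · intro a b h₁ h₂
    have ha := f.2.2.1 a ((mem_cells _).1 a.2)
    have := f.2.2.2.2.1 a ((mem_cells _).1 a.2) b ((mem_cells _).1 b.2) h₁ h₂
    rw [Fin.lt_def]
    simp only
    omega
  · intro a b h₁ h₂
    have ha := f.2.2.1 a ((mem_cells _).1 a.2)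
    have := f.2.2.2.2.2 a ((mem_cells _).1 a.2) b ((mem_cells _).1 b.2) h₁ h₂
    rw [Fin.lt_def]
    simp only
    omega
  · constructor
    · intro f g hfg
      ext c
      by_cases hc : c ∈ μ
      · have h₁ := f.2.2.1 c hc
        have h₂ := g.2.2.1 c hc
        have h₃ := congrArg Fin.val (congrFun (congrArg Subtype.val hfg) ⟨c, (mem_cells _).2 hc⟩)
        simp only at h₃
        omega
      · rw [f.2.1 c hc, g.2.1 c hc]
    · rintro ⟨g, hbij, hrow, hcol⟩
      have hval : ∀ c (hc : c ∈ μ), (if hc : c ∈ μ.cells then (g ⟨c, hc⟩ : ℕ) + 1 else 0) =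
          g ⟨c, (mem_cells _).2 hc⟩ + 1 := fun c hc => dif_pos ((mem_cells _).2 hc)
      refine ⟨⟨fun c => if hc : c ∈ μ.cells then (g ⟨c, hc⟩ : ℕ) + 1 else 0,
        fun c hc => dif_neg (mt (mem_cells _).1 hc), fun c hc => ?_, fun c hc d hd => ?_,
        fun c hc d hd h₁ h₂ => ?_, fun c hc d hd h₁ h₂ => ?_⟩, ?_⟩
      · beta_reduce
        rw [hval c hc]
        have := (g ⟨c, (mem_cells _).2 hc⟩).2
        omega
      · beta_reduce
        rw [hval c hc, hval d hd]
        intro he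
        exact congrArg Subtype.val (hbij.1 (Fin.ext (Nat.succ_injective he)))
      · beta_reduce
        rw [hval c hc, hval d hd]
        exact Nat.succ_lt_succ (hrow ⟨c, (mem_cells _).2 hc⟩ ⟨d, (mem_cells _).2 hd⟩ h₁ h₂)
      · beta_reduce
        rw [hval c hc, hval d hd]
        exact Nat.succ_lt_succ (hcol ⟨c, (mem_cells _).2 hc⟩ ⟨d, (mem_cells _).2 hd⟩ h₁ h₂)
      · ext c
        simp

end YoungDiagram

end

/-- Hook length formula (Frame–Robinson–Thrall): the number of standard Young
tableaux of shape `μ` equals `|μ|!` divided by the product of the hook lengths of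
all boxes of `μ` (stated multiplied through by the product of hook lengths). -/
theorem statement17 (μ : YoungDiagram) :
    Nat.card {f : μ.cells → Fin μ.card // Function.Bijective f ∧
        (∀ a b : μ.cells, a.1.1 = b.1.1 → a.1.2 < b.1.2 → f a < f b) ∧
        (∀ a b : μ.cells, a.1.2 = b.1.2 → a.1.1 < b.1.1 → f a < f b)} *
      ∏ c ∈ μ.cells, hookLength μ c = Nat.factorial μ.card := by
  rw [μ.natCard_subtype_eq_card_standardTableaux]
  exact_mod_cast YoungDiagram.card_standardTableaux_mul_prod_hookLength μ.card μ rfl
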